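/- Let n ≥ 2 and let σ be a cycle of length n on ℤ/nℤ. Suppose the orbit of σ under the map T (conjugation by the rotation τ: a ↦ a+1) has size h ≥ 2. Then in ℤ[q], the sum Σ_{k=0}^{h−1} q^{maj(T^k σ)} is congruent to 0 modulo the n-th cyclotomic polynomial Φ_n(q). -/

import Mathlib

open Finset Polynomial

/-- The representative in `{1,…,n}` of a residue class `a : ZMod n`. -/
def zrep (n : ℕ) (a : ZMod n) : ℕ := if a.val = 0 then n else a.val

/-- The major index of a permutation of `{1,…,n}` (identified with `ZMod n`). -/
def maj (n : ℕ) (σ : Equiv.Perm (ZMod n)) : ℕ :=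
  ∑ i ∈ Finset.Icc 1 (n - 1),
    if zrep n (σ ((i : ZMod n) + 1)) < zrep n (σ (i : ZMod n)) then i else 0

/-- The cyclic major index. -/
def majbar (n : ℕ) (σ : Equiv.Perm (ZMod n)) : ℕ :=
  ∑ i ∈ Finset.Icc 1 n,
    if zrep n (σ ((i : ZMod n) + 1)) < zrep n (σ (i : ZMod n)) then i else 0

/-- The cyclic descent number. -/
def desbar (n : ℕ) (σ : Equiv.Perm (ZMod n)) : ℕ :=
  ((Finset.Icc 1 n).filter
    (fun i : ℕ => zrep n (σ (((i : ℕ) : ZMod n) + 1)) < zrep n (σ ((i : ℕ) : ZMod n)))).card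

/-- Conjugation by the rotation `a ↦ a + 1`. -/
def Tmap (n : ℕ) (σ : Equiv.Perm (ZMod n)) : Equiv.Perm (ZMod n) :=
  Equiv.addRight (1 : ZMod n) * σ * (Equiv.addRight (1 : ZMod n))⁻¹

theorem zrep_cast (n : ℕ) [NeZero n] (x : ZMod n) : ((zrep n x : ℕ) : ZMod n) = x := by
  unfold zrep
  split_ifs with h
  · rw [ZMod.natCast_self, (ZMod.val_eq_zero x).mp h]
  · exact ZMod.natCast_zmod_val x

theorem zrep_pos (n : ℕ) [NeZero n] (x : ZMod n) : 1 ≤ zrep n x := by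
  have := NeZero.pos n
  unfold zrep
  split_ifs <;> omega

theorem zrep_le (n : ℕ) [NeZero n] (x : ZMod n) : zrep n x ≤ n := by
  have := ZMod.val_lt x
  unfold zrep
  split_ifs <;> omega

/-- The indicator of a descent from the value `x` to the value `y`. -/
def descInd (n : ℕ) (x y : ZMod n) : ℤ := if zrep n y < zrep n x then 1 else 0

theorem mul_descInd (n : ℕ) [NeZero n] (x y : ZMod n) :
    (n : ℤ) * descInd n x y = (y - x).val - zrep n y + zrep n x := by
  have hdvd : (n : ℤ) ∣ (y - x).val - zrep n y + zrep n x := by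
    rw [← ZMod.intCast_zmod_eq_zero_iff_dvd]
    push_cast
    simp [zrep_cast]
  obtain ⟨c, hc⟩ := hdvd
  have hv := ZMod.val_lt (y - x)
  have hn := NeZero.pos n
  have h1 := zrep_pos n x
  have h2 := zrep_pos n y
  have h3 := zrep_le n x
  have h4 := zrep_le n y
  rw [hc]
  congr 1
  unfold descInd
  split_ifs with h
  · have : 0 < c := by
      by_contra hcon
      nlinarith
    have : c < 2 := by
      by_contra hcon
      nlinarith
    omega
  · have : -1 < c := by
      by_contra hcon
      nlinarith
    have : c < 1 := by
      by_contra hcon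
      nlinarith
    omega

theorem zrep_add_one (n : ℕ) [NeZero n] (hn : 2 ≤ n) (x : ZMod n) :
    (zrep n (x + 1) : ℤ) = zrep n x + 1 - n * (if x = 0 then 1 else 0) := by
  have hdvd : (n : ℤ) ∣ zrep n (x + 1) - zrep n x - 1 := by
    rw [← ZMod.intCast_zmod_eq_zero_iff_dvd]
    push_cast
    simp [zrep_cast]
  obtain ⟨c, hc⟩ := hdvd
  have h1 := zrep_pos n (x + 1)
  have h2 := zrep_le n (x + 1)
  split_ifs with h
  · have hx : zrep n x = n := by simp [zrep, h]
    rw [hx] at hc ⊢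
    have : -2 < c := by
      by_contra hcon
      nlinarith
    have : c < 0 := by
      by_contra hcon
      nlinarith
    obtain rfl : c = -1 := by omega
    linarith
  · have hx : zrep n x < n := by
      have hv := ZMod.val_lt x
      have : x.val ≠ 0 := by rwa [Ne, ZMod.val_eq_zero]
      simpa [zrep, this] using hv
    have h3 := zrep_pos n x
    have : -1 < c := by
      by_contra hcon
      nlinarith
    have : c < 1 := by
      by_contra hcon
      nlinarith
    obtain rfl : c = 0 := by omega
    linarith

theorem descInd_add_one (n : ℕ) [NeZero n] (hn : 2 ≤ n) (x y : ZMod n) :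
    descInd n (x + 1) (y + 1) =
      descInd n x y + (if y = 0 then 1 else 0) - (if x = 0 then 1 else 0) := by
  have hn0 : (n : ℤ) ≠ 0 := by exact_mod_cast NeZero.ne n
  apply mul_left_cancel₀ hn0
  have h := mul_descInd n (x + 1) (y + 1)
  rw [add_sub_add_right_eq_sub, zrep_add_one n hn, zrep_add_one n hn] at h
  rw [h, mul_sub, mul_add, mul_descInd]
  ring

/-- The number of cyclic descents of `σ`. -/
def cyclicDes (n : ℕ) [NeZero n] (σ : Equiv.Perm (ZMod n)) : ℤ :=
  ∑ i, descInd n (σ i) (σ (i + 1))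

/-- The sum of the positions of the cyclic descents of `σ`, modulo `n`. -/
def cyclicMaj (n : ℕ) [NeZero n] (σ : Equiv.Perm (ZMod n)) : ZMod n :=
  ∑ i, i * (descInd n (σ i) (σ (i + 1)) : ZMod n)

theorem maj_cast (n : ℕ) [NeZero n] (σ : Equiv.Perm (ZMod n)) :
    ((maj n σ : ℕ) : ZMod n) = cyclicMaj n σ := by
  have hn := NeZero.pos n
  have hsum : cyclicMaj n σ = ∑ i ∈ Finset.range n,
      ((i : ZMod n) * (descInd n (σ (i : ZMod n)) (σ ((i : ZMod n) + 1)) : ZMod n)) := by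
    refine Finset.sum_nbij' (fun x => x.val) (fun i => (i : ZMod n)) ?_ ?_ ?_ ?_ ?_
    · exact fun x _ => Finset.mem_range.mpr (ZMod.val_lt x)
    · simp
    · simp
    · exact fun i hi => ZMod.val_cast_of_lt (Finset.mem_range.mp hi)
    · simp
  rw [hsum, maj, Nat.cast_sum]
  apply Finset.sum_subset_zero_on_sdiff
  · intro i hi
    rw [Finset.mem_Icc] at hi
    rw [Finset.mem_range]
    omega
  · intro i hi
    simp only [Finset.mem_sdiff, Finset.mem_range, Finset.mem_Icc] at hi
    obtain rfl : i = 0 := by omega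
    simp
  · intro i _
    unfold descInd
    split_ifs <;> simp

theorem Tmap_apply (n : ℕ) (σ : Equiv.Perm (ZMod n)) (i : ZMod n) :
    Tmap n σ i = σ (i - 1) + 1 := by
  simp [Tmap, sub_eq_add_neg]

theorem Tmap_injective (n : ℕ) : Function.Injective (Tmap n) := by
  intro a b hab
  simpa [Tmap] using hab

theorem mul_cyclicDes (n : ℕ) [NeZero n] (σ : Equiv.Perm (ZMod n)) :
    (n : ℤ) * cyclicDes n σ = ∑ i, ((σ (i + 1) - σ i).val : ℤ) := by
  have h : ∑ i, (zrep n (σ (i + 1)) : ℤ) = ∑ i, (zrep n (σ i) : ℤ) :=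
    Equiv.sum_comp (Equiv.addRight (1 : ZMod n)) fun i => (zrep n (σ i) : ℤ)
  simp only [cyclicDes, Finset.mul_sum, mul_descInd, Finset.sum_add_distrib,
    Finset.sum_sub_distrib, h]
  ring

theorem descInd_Tmap (n : ℕ) [NeZero n] (hn : 2 ≤ n) (σ : Equiv.Perm (ZMod n)) (i : ZMod n) :
    descInd n (Tmap n σ (i + 1)) (Tmap n σ (i + 1 + 1)) = descInd n (σ i) (σ (i + 1)) +
      (if i + 1 = σ.symm 0 then 1 else 0) - (if i = σ.symm 0 then 1 else 0) := by
  simp only [Tmap_apply, add_sub_cancel_right, descInd_add_one n hn, Equiv.eq_symm_apply]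

theorem cyclicDes_Tmap (n : ℕ) [NeZero n] (σ : Equiv.Perm (ZMod n)) :
    cyclicDes n (Tmap n σ) = cyclicDes n σ := by
  have hn0 : (n : ℤ) ≠ 0 := by exact_mod_cast NeZero.ne n
  apply mul_left_cancel₀ hn0
  rw [mul_cyclicDes, mul_cyclicDes, ← Equiv.sum_comp (Equiv.addRight (1 : ZMod n))]
  simp [Tmap_apply]

theorem cyclicMaj_Tmap (n : ℕ) [NeZero n] (hn : 2 ≤ n) (σ : Equiv.Perm (ZMod n)) :
    cyclicMaj n (Tmap n σ) = cyclicMaj n σ + (cyclicDes n σ - 1 : ℤ) := by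
  rw [cyclicMaj, ← Equiv.sum_comp (Equiv.addRight (1 : ZMod n))]
  simp only [Equiv.coe_addRight, descInd_Tmap n hn, ← eq_sub_iff_add_eq]
  push_cast
  simp only [mul_add, mul_sub, Finset.sum_add_distrib, Finset.sum_sub_distrib, mul_ite, mul_one,
    mul_zero, add_mul, one_mul, Finset.sum_ite_eq', Finset.mem_univ, if_true, cyclicMaj, cyclicDes]
  simp
  ring

theorem cyclicDes_iterate (n : ℕ) [NeZero n] (σ : Equiv.Perm (ZMod n)) (k : ℕ) :
    cyclicDes n ((Tmap n)^[k] σ) = cyclicDes n σ := by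
  induction k with
  | zero => rfl
  | succ k ih => rw [Function.iterate_succ_apply', cyclicDes_Tmap, ih]

theorem cyclicMaj_iterate (n : ℕ) [NeZero n] (hn : 2 ≤ n) (σ : Equiv.Perm (ZMod n)) (k : ℕ) :
    cyclicMaj n ((Tmap n)^[k] σ) = cyclicMaj n σ + k * (cyclicDes n σ - 1 : ℤ) := by
  induction k with
  | zero => simp
  | succ k ih =>
    rw [Function.iterate_succ_apply', cyclicMaj_Tmap n hn, ih, cyclicDes_iterate]
    push_cast
    ring

theorem one_le_val_sub (n : ℕ) [NeZero n] (hn : 2 ≤ n) (σ : Equiv.Perm (ZMod n)) (i : ZMod n) :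
    1 ≤ (σ (i + 1) - σ i).val := by
  have : Fact (1 < n) := ⟨hn⟩
  rw [Nat.one_le_iff_ne_zero, Ne, ZMod.val_eq_zero, sub_eq_zero, σ.injective.eq_iff]
  simp

/-- A permutation with exactly one cyclic descent is a rotation, hence fixed by `Tmap`. -/
theorem Tmap_eq_of_cyclicDes_eq_one (n : ℕ) [NeZero n] (hn : 2 ≤ n) (σ : Equiv.Perm (ZMod n))
    (hd : cyclicDes n σ = 1) : Tmap n σ = σ := by
  have hsum := mul_cyclicDes n σ
  rw [hd, mul_one] at hsum
  have hle : ∀ i ∈ (Finset.univ : Finset (ZMod n)), (1 : ℤ) ≤ (σ (i + 1) - σ i).val :=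
    fun i _ => by exact_mod_cast one_le_val_sub n hn σ i
  have heq := (Finset.sum_eq_sum_iff_of_le hle).mp (by rw [← hsum]; simp [ZMod.card])
  ext1 i
  have hi : (σ (i - 1 + 1) - σ (i - 1)).val = 1 := by
    exact_mod_cast (heq (i - 1) (Finset.mem_univ _)).symm
  have hv := ZMod.natCast_zmod_val (σ (i - 1 + 1) - σ (i - 1))
  rw [hi, sub_add_cancel, Nat.cast_one] at hv
  rw [Tmap_apply, add_comm]
  exact eq_sub_iff_add_eq.mp hv

theorem cyclicDes_eq_one_of_cast (n : ℕ) [NeZero n] (hn : 2 ≤ n) (σ : Equiv.Perm (ZMod n))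
    (hd : ((cyclicDes n σ - 1 : ℤ) : ZMod n) = 0) : cyclicDes n σ = 1 := by
  have hn0 : (0 : ℤ) < n := by exact_mod_cast NeZero.pos n
  have hsum := mul_cyclicDes n σ
  have hlo : ∑ _i : ZMod n, (1 : ℤ) ≤ ∑ i, ((σ (i + 1) - σ i).val : ℤ) :=
    Finset.sum_le_sum fun i _ => by exact_mod_cast one_le_val_sub n hn σ i
  have hhi : ∑ i, ((σ (i + 1) - σ i).val : ℤ) ≤ ∑ _i : ZMod n, ((n : ℤ) - 1) :=
    Finset.sum_le_sum fun i _ => by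
      have := ZMod.val_lt (σ (i + 1) - σ i)
      omega
  rw [← hsum] at hlo hhi
  simp only [Finset.sum_const, Finset.card_univ, ZMod.card, nsmul_eq_mul] at hlo hhi
  have h1 := le_of_mul_le_mul_left hlo hn0
  have h2 := le_of_mul_le_mul_left hhi hn0
  rw [ZMod.intCast_zmod_eq_zero_iff_dvd] at hd
  have := Int.eq_zero_of_dvd_of_nonneg_of_lt (by omega) (by omega) hd
  omega

theorem ncard_orbit_eq_minimalPeriod {α : Type*} {f : α → α} {x : α}
    (hx : x ∈ Function.periodicPts f) :
    Set.ncard {y | ∃ k : ℕ, f^[k] x = y} = Function.minimalPeriod f x := by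
  have hset : {y | ∃ k : ℕ, f^[k] x = y} =
      (fun k => f^[k] x) '' Set.Iio (Function.minimalPeriod f x) := by
    ext y
    constructor
    · rintro ⟨k, rfl⟩
      exact ⟨k % Function.minimalPeriod f x,
        Nat.mod_lt _ (Function.minimalPeriod_pos_of_mem_periodicPts hx),
        Function.iterate_mod_minimalPeriod_eq⟩
    · rintro ⟨k, _, rfl⟩
      exact ⟨k, rfl⟩
  rw [hset, Function.iterate_injOn_Iio_minimalPeriod.ncard_image,
    Set.ncard_eq_toFinset_card']
  simp

/-- if the T-orbit of an n-cycle σ has size h ≥ 2, then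
`Σ_{k=0}^{h-1} q^{maj(T^k σ)} ≡ 0 (mod Φ_n(q))` in ℤ[q]. -/
theorem orbit_sum_cong_zero (n : ℕ) [NeZero n] (hn : 2 ≤ n) (σ : Equiv.Perm (ZMod n))
    (hc : σ.IsCycle) (hs : σ.support.card = n) (h : ℕ)
    (hh : h = Set.ncard {ρ : Equiv.Perm (ZMod n) | ∃ k : ℕ, (Tmap n)^[k] σ = ρ})
    (h2 : 2 ≤ h) :
    Polynomial.cyclotomic n ℤ ∣
      ∑ k ∈ Finset.range h, (Polynomial.X : Polynomial ℤ) ^ maj n ((Tmap n)^[k] σ) := by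
  rw [ncard_orbit_eq_minimalPeriod ((Tmap_injective n).mem_periodicPts σ)] at hh
  have hζ := Complex.isPrimitiveRoot_exp n (NeZero.ne n)
  set ζ := Complex.exp (2 * Real.pi * Complex.I / n)
  rw [Polynomial.cyclotomic_eq_minpoly hζ (NeZero.pos n)]
  apply minpoly.isIntegrallyClosed_dvd (hζ.isIntegral (NeZero.pos n))
  simp only [map_sum, map_pow, Polynomial.aeval_X]
  set D : ℕ := ((cyclicDes n σ - 1 : ℤ) : ZMod n).val
  have hDcast : (D : ZMod n) = ((cyclicDes n σ - 1 : ℤ) : ZMod n) := ZMod.natCast_zmod_val _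
  have hpow (k : ℕ) : ζ ^ maj n ((Tmap n)^[k] σ) = ζ ^ maj n σ * (ζ ^ D) ^ k := by
    rw [← pow_mul, ← pow_add]
    suffices hmod : maj n ((Tmap n)^[k] σ) ≡ maj n σ + D * k [MOD n] by
      rw [← pow_mod_orderOf ζ (maj n _), ← pow_mod_orderOf ζ (_ + _), ← hζ.eq_orderOf, hmod]
    rw [← ZMod.natCast_eq_natCast_iff, maj_cast, cyclicMaj_iterate n hn]
    push_cast
    rw [maj_cast, hDcast]
    push_cast
    ring
  have hζ0 : ζ ^ maj n σ ≠ 0 := pow_ne_zero _ (hζ.ne_zero (NeZero.ne n))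
  have hper : (ζ ^ D) ^ h = 1 := by
    have hp := hpow h
    rw [hh, Function.iterate_minimalPeriod] at hp
    rw [hh]
    exact (mul_eq_left₀ hζ0).mp hp.symm
  have hne : ζ ^ D - 1 ≠ 0 := by
    rw [sub_ne_zero]
    intro hone
    rw [hζ.pow_eq_one_iff_dvd, ← ZMod.natCast_eq_zero_iff, hDcast] at hone
    have hfix : Function.IsFixedPt (Tmap n) σ :=
      Tmap_eq_of_cyclicDes_eq_one n hn σ (cyclicDes_eq_one_of_cast n hn σ hone)
    rw [← Function.minimalPeriod_eq_one_iff_isFixedPt] at hfix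
    omega
  simp only [hpow, ← Finset.mul_sum]
  have hgeom := geom_sum_mul (ζ ^ D) h
  rw [hper, sub_self] at hgeom
  rw [(mul_eq_zero.mp hgeom).resolve_right hne, mul_zero]
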